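/- Let ρ, σ be positive definite density matrices on ℂ^n and let Φ be a quantum channel from Mat_n(ℂ) to Mat_m(ℂ) given in Kraus form Φ(X) = Σ_k A_k X A_k† with Σ_k A_k† A_k = I, such that Φ(ρ) and Φ(σ) are positive definite. Then D(Φ(σ)‖Φ(ρ)) ≤ D(σ‖ρ), where D denotes the Umegaki relative entropy Tr(σ(log σ − log ρ)). -/

import Mathlib

open scoped ComplexOrder Matrix

/-- Matrix logarithm of a Hermitian matrix via the spectral theorem
(junk value `0` on non-Hermitian matrices). -/
noncomputable def matLog {I : Type*} [Fintype I] [DecidableEq I]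
    (A : Matrix I I ℂ) : Matrix I I ℂ :=
  if hA : A.IsHermitian then
    (hA.eigenvectorUnitary : Matrix I I ℂ) *
      Matrix.diagonal (fun i => (Real.log (hA.eigenvalues i) : ℂ)) *
      star (hA.eigenvectorUnitary : Matrix I I ℂ)
  else 0

/-- The Umegaki quantum relative entropy `D(σ‖ρ) = Tr(σ(log σ − log ρ))`. -/
noncomputable def qRelEnt {I : Type*} [Fintype I] [DecidableEq I]
    (σ ρ : Matrix I I ℂ) : ℝ :=
  ((σ * (matLog σ - matLog ρ)).trace).re

open Matrix in
/-- Kadison-Schwarz inequality in trace form. -/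
theorem dpi_kadison {n m K : ℕ} (P : Matrix (Fin n) (Fin n) ℂ) (hP : P.PosDef)
    (A : Fin K → Matrix (Fin m) (Fin n) ℂ) (hA : ∑ k, (A k)ᴴ * A k = 1)
    (Y : Matrix (Fin m) (Fin m) ℂ) (X : Matrix (Fin n) (Fin n) ℂ)
    (hX : X = ∑ k, (A k)ᴴ * Y * A k) :
    (Xᴴ * P * X).trace.re ≤ (Yᴴ * (∑ k, A k * P * (A k)ᴴ) * Y).trace.re := by
  have hXH : Xᴴ = ∑ k, (A k)ᴴ * Yᴴ * A k := by
    rw [hX, conjTranspose_sum]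
    simp [Matrix.mul_assoc]
  have h1 : (∑ k, (Yᴴ * A k - A k * Xᴴ)ᴴ * (Yᴴ * A k - A k * Xᴴ))
      = (∑ k, (A k)ᴴ * (Y * Yᴴ) * A k) - X * Xᴴ := by
    have e1 : ∀ k, (Yᴴ * A k - A k * Xᴴ)ᴴ * (Yᴴ * A k - A k * Xᴴ)
        = (A k)ᴴ * (Y * Yᴴ) * A k - ((A k)ᴴ * Y * A k) * Xᴴ - X * ((A k)ᴴ * Yᴴ * A k)
          + X * ((A k)ᴴ * A k) * Xᴴ := by
      intro k
      simp only [conjTranspose_sub, conjTranspose_mul, conjTranspose_conjTranspose,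
        Matrix.sub_mul, Matrix.mul_sub, Matrix.mul_assoc]
      abel
    simp only [e1, Finset.sum_add_distrib, Finset.sum_sub_distrib, ← Finset.sum_mul,
      ← Finset.mul_sum]
    rw [hA, ← hX, ← hXH, Matrix.mul_one]
    abel
  have h2 : 0 ≤ (P * ∑ k, (Yᴴ * A k - A k * Xᴴ)ᴴ * (Yᴴ * A k - A k * Xᴴ)).trace.re := by
    rw [Finset.mul_sum, trace_sum, Complex.re_sum]
    refine Finset.sum_nonneg fun k _ => ?_
    rw [← Matrix.mul_assoc, Matrix.trace_mul_comm, ← Matrix.mul_assoc]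
    have := (hP.posSemidef.mul_mul_conjTranspose_same (Yᴴ * A k - A k * Xᴴ)).trace_nonneg
    exact (Complex.le_def.1 this).1
  rw [h1, Matrix.mul_sub, trace_sub, Complex.sub_re] at h2
  have h3 : (Xᴴ * P * X).trace = (P * (X * Xᴴ)).trace := by
    rw [Matrix.mul_assoc, Matrix.trace_mul_comm, Matrix.mul_assoc]
  have h4 : (Yᴴ * (∑ k, A k * P * (A k)ᴴ) * Y).trace
      = (P * ∑ k, (A k)ᴴ * (Y * Yᴴ) * A k).trace := by
    rw [Matrix.mul_assoc, Matrix.trace_mul_comm, Matrix.mul_assoc, Finset.sum_mul,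
      Finset.mul_sum, trace_sum, trace_sum]
    refine Finset.sum_congr rfl fun k _ => ?_
    rw [Matrix.mul_assoc (A k), Matrix.mul_assoc (A k), Matrix.trace_mul_comm]
    simp only [Matrix.mul_assoc]
  rw [h3, h4]
  linarith

/-- Completing the square. -/
theorem dpi_square (a : ℝ) (ha : 0 < a) (c z : ℂ) (q : ℝ) :
    2 * (q * (star c * z)).re - a * Complex.normSq z ≤ Complex.normSq c * q ^ 2 / a := by
  rw [le_div_iff₀ ha]
  have h : 0 ≤ Complex.normSq (a * z - q * c) := Complex.normSq_nonneg _
  simp [Complex.normSq_apply] at h ⊢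
  nlinarith

theorem dpi_square_eq (a : ℝ) (ha : 0 < a) (c : ℂ) (q : ℝ) :
    2 * (q * (star c * (((q / a : ℝ) : ℂ) * c))).re
      - a * Complex.normSq (((q / a : ℝ) : ℂ) * c) = Complex.normSq c * q ^ 2 / a := by
  simp [Complex.normSq_apply]
  field_simp
  ring

/-- Variational functional. -/
noncomputable def dpiF {I : Type*} [Fintype I] [DecidableEq I]
    (σ ρ : Matrix I I ℂ) (t : ℝ) (X : Matrix I I ℂ) : ℝ :=
  2 * (σ * X).trace.re - (Xᴴ * ρ * X).trace.re - t * (X * σ * Xᴴ).trace.re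

open Matrix in
theorem dpi_spectral {I : Type*} [Fintype I] [DecidableEq I] (σ ρ : Matrix I I ℂ)
    (hσ : σ.PosDef) (hρ : ρ.PosDef) (hσ1 : σ.trace = 1) :
    ∃ (w : I → I → ℝ) (p q : I → ℝ), (∀ i, 0 < p i) ∧ (∀ j, 0 < q j) ∧
      (∑ i, ∑ j, w i j * q j = 1) ∧
      qRelEnt σ ρ = ∑ i, ∑ j, w i j * q j * (Real.log (q j) - Real.log (p i)) ∧
      (∀ t, 0 ≤ t → ∀ X, dpiF σ ρ t X ≤ ∑ i, ∑ j, w i j * q j ^ 2 / (p i + t * q j)) ∧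
      (∀ t, 0 ≤ t → ∃ X, dpiF σ ρ t X = ∑ i, ∑ j, w i j * q j ^ 2 / (p i + t * q j)) := by
  have hU1 := Unitary.coe_star_mul_self hρ.1.eigenvectorUnitary
  have hV1 := Unitary.coe_star_mul_self hσ.1.eigenvectorUnitary
  have hρs := hρ.1.spectral_theorem
  have hσs := hσ.1.spectral_theorem
  have hlρ : matLog ρ = (hρ.1.eigenvectorUnitary : Matrix I I ℂ) *
      Matrix.diagonal (fun i => (Real.log (hρ.1.eigenvalues i) : ℂ)) *
      star (hρ.1.eigenvectorUnitary : Matrix I I ℂ) := by rw [matLog, dif_pos hρ.1]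
  have hlσ : matLog σ = (hσ.1.eigenvectorUnitary : Matrix I I ℂ) *
      Matrix.diagonal (fun i => (Real.log (hσ.1.eigenvalues i) : ℂ)) *
      star (hσ.1.eigenvectorUnitary : Matrix I I ℂ) := by rw [matLog, dif_pos hσ.1]
  have hp := hρ.eigenvalues_pos
  have hq := hσ.eigenvalues_pos
  rw [Unitary.conjStarAlgAut_apply] at hρs hσs
  simp only [star_eq_conjTranspose] at *
  generalize hρ.1.eigenvalues = p at *
  generalize hσ.1.eigenvalues = q at *
  generalize (hρ.1.eigenvectorUnitary : Matrix I I ℂ) = U at *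
  generalize (hσ.1.eigenvectorUnitary : Matrix I I ℂ) = V at *
  have hd : ∀ p : I → ℝ, (RCLike.ofReal ∘ p : I → ℂ) = fun i => (p i : ℂ) := fun _ => rfl
  rw [hd] at hρs hσs
  clear hσ hρ
  have hU2 : U * Uᴴ = 1 := mul_eq_one_comm.mp hU1
  have hV2 : V * Vᴴ = 1 := mul_eq_one_comm.mp hV1
  -- trace of a product of the two kinds of functions
  have key : ∀ f g : I → ℝ, ((V * diagonal (fun j => (g j : ℂ)) * Vᴴ) *
      (U * diagonal (fun i => (f i : ℂ)) * Uᴴ)).trace.re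
      = ∑ i, ∑ j, Complex.normSq ((Uᴴ * V) i j) * g j * f i := by
    intro f g
    have : ((V * diagonal (fun j => (g j : ℂ)) * Vᴴ) *
      (U * diagonal (fun i => (f i : ℂ)) * Uᴴ)).trace
      = ((Uᴴ * V) * diagonal (fun j => (g j : ℂ)) * ((Uᴴ * V)ᴴ * diagonal (fun i => (f i : ℂ)))).trace := by
      rw [← Matrix.mul_assoc, Matrix.trace_mul_comm]
      simp only [conjTranspose_mul, conjTranspose_conjTranspose, Matrix.mul_assoc]
    rw [this]
    generalize Uᴴ * V = W
    simp only [Matrix.trace, Matrix.diag, Matrix.mul_apply (M := W * _), mul_diagonal,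
      conjTranspose_apply, Complex.re_sum]
    refine Finset.sum_congr rfl fun i _ => Finset.sum_congr rfl fun j _ => ?_
    simp [Complex.normSq_apply]
    ring
  have hVc : ∀ f g : I → ℝ, ((V * diagonal (fun j => (g j : ℂ)) * Vᴴ) *
      (V * diagonal (fun i => (f i : ℂ)) * Vᴴ))
      = (V * diagonal (fun j => ((g j * f j : ℝ) : ℂ)) * Vᴴ) * (U * diagonal (fun _ => ((1:ℝ) : ℂ)) * Uᴴ) := by
    intro f g
    have h1 : diagonal (fun _ : I => ((1:ℝ) : ℂ)) = 1 := by simp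
    rw [h1, Matrix.mul_one, hU2, Matrix.mul_one]
    simp only [Complex.ofReal_mul, ← diagonal_mul_diagonal]
    calc _ = V * diagonal (fun j => (g j : ℂ)) * (Vᴴ * V) * diagonal (fun i => (f i : ℂ)) * Vᴴ := by
          simp only [Matrix.mul_assoc]
      _ = _ := by rw [hV1, Matrix.mul_one]; simp only [Matrix.mul_assoc]
  have hF : ∀ t Z, dpiF σ ρ t (U * Z * Vᴴ) = ∑ i, ∑ j,
      (2 * (q j * (star ((Uᴴ * V) i j) * Z i j)).re - (p i + t * q j) * Complex.normSq (Z i j)) := by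
    intro t Z
    have e1 : (σ * (U * Z * Vᴴ)).trace = (diagonal (fun j => (q j : ℂ)) * (Uᴴ * V)ᴴ * Z).trace := by
      rw [Matrix.mul_assoc U, ← Matrix.mul_assoc, ← Matrix.mul_assoc, Matrix.trace_mul_comm, hσs]
      simp only [conjTranspose_mul, conjTranspose_conjTranspose, Matrix.mul_assoc]
      rw [← Matrix.mul_assoc Vᴴ V, hV1, Matrix.one_mul]
    have e2 : ((U * Z * Vᴴ)ᴴ * ρ * (U * Z * Vᴴ)).trace
        = (Zᴴ * (diagonal (fun i => (p i : ℂ)) * Z)).trace := by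
      rw [← Matrix.mul_assoc, Matrix.trace_mul_comm, hρs]
      simp only [conjTranspose_mul, conjTranspose_conjTranspose, Matrix.mul_assoc]
      rw [← Matrix.mul_assoc Vᴴ V, hV1, Matrix.one_mul, ← Matrix.mul_assoc Uᴴ U, hU1, Matrix.one_mul,
        ← Matrix.mul_assoc Uᴴ U, hU1, Matrix.one_mul]
    have e3 : ((U * Z * Vᴴ) * σ * (U * Z * Vᴴ)ᴴ).trace
        = (Z * diagonal (fun i => (q i : ℂ)) * Zᴴ).trace := by
      rw [Matrix.mul_assoc U, Matrix.mul_assoc U, Matrix.mul_assoc U, Matrix.trace_mul_comm, hσs]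
      simp only [conjTranspose_mul, conjTranspose_conjTranspose, Matrix.mul_assoc]
      rw [hU1, Matrix.mul_one, ← Matrix.mul_assoc Vᴴ V, hV1, Matrix.one_mul,
        ← Matrix.mul_assoc Vᴴ V, hV1, Matrix.one_mul]
    rw [dpiF, e1, e2, e3]
    generalize Uᴴ * V = W
    have f1 : (diagonal (fun j => (q j : ℂ)) * Wᴴ * Z).trace.re
        = ∑ i, ∑ j, (q j * (star (W i j) * Z i j)).re := by
      rw [Finset.sum_comm]
      simp only [Matrix.trace, Matrix.diag, Matrix.mul_apply (N := Z), diagonal_mul,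
        conjTranspose_apply, Complex.re_sum, mul_assoc]
    have f2 : (Zᴴ * (diagonal (fun i => (p i : ℂ)) * Z)).trace.re
        = ∑ i, ∑ j, p i * Complex.normSq (Z i j) := by
      rw [Finset.sum_comm]
      simp only [Matrix.trace, Matrix.diag, Matrix.mul_apply (M := Zᴴ), diagonal_mul,
        conjTranspose_apply, Complex.re_sum]
      refine Finset.sum_congr rfl fun i _ => Finset.sum_congr rfl fun j _ => ?_
      simp [Complex.normSq_apply]
      ring
    have f3 : (Z * diagonal (fun i => (q i : ℂ)) * Zᴴ).trace.re
        = ∑ i, ∑ j, q j * Complex.normSq (Z i j) := by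
      simp only [Matrix.trace, Matrix.diag, Matrix.mul_apply (N := Zᴴ), mul_diagonal,
        conjTranspose_apply, Complex.re_sum]
      refine Finset.sum_congr rfl fun i _ => Finset.sum_congr rfl fun j _ => ?_
      simp [Complex.normSq_apply]
      ring
    rw [f1, f2, f3]
    simp only [Finset.mul_sum, ← Finset.sum_sub_distrib]
    refine Finset.sum_congr rfl fun i _ => Finset.sum_congr rfl fun j _ => ?_
    ring
  have hpos : ∀ t, 0 ≤ t → ∀ i j, 0 < p i + t * q j := fun t ht i j =>
    add_pos_of_pos_of_nonneg (hp i) (mul_nonneg ht (hq j).le)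
  refine ⟨fun i j => Complex.normSq ((Uᴴ * V) i j), p, q, hp, hq, ?_, ?_, ?_, ?_⟩
  · have := key (fun _ => 1) q
    have h1 : diagonal (fun _ : I => ((1:ℝ) : ℂ)) = 1 := by simp
    rw [h1, Matrix.mul_one, hU2, Matrix.mul_one, ← hσs, hσ1] at this
    simpa using this.symm
  · rw [qRelEnt, Matrix.mul_sub, trace_sub, Complex.sub_re, hlσ, hlρ, hσs, hVc, key, key]
    simp only [← Finset.sum_sub_distrib]
    refine Finset.sum_congr rfl fun i _ => Finset.sum_congr rfl fun j _ => ?_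
    ring
  · intro t ht X
    have hX : X = U * (Uᴴ * X * V) * Vᴴ := by
      calc X = (U * Uᴴ) * X * (V * Vᴴ) := by rw [hU2, hV2]; simp
        _ = _ := by simp only [Matrix.mul_assoc]
    rw [hX, hF]
    exact Finset.sum_le_sum fun i _ => Finset.sum_le_sum fun j _ =>
      dpi_square _ (hpos t ht i j) _ _ _
  · intro t ht
    refine ⟨U * (Matrix.of fun i j => ((q j / (p i + t * q j) : ℝ) : ℂ) * (Uᴴ * V) i j) * Vᴴ, ?_⟩
    rw [hF]
    exact Finset.sum_congr rfl fun i _ => Finset.sum_congr rfl fun j _ =>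
      dpi_square_eq _ (hpos t ht i j) _ _

/-- Truncated integral representation of the relative entropy. -/
noncomputable def dpiG {I : Type*} [Fintype I] (w : I → I → ℝ) (p q : I → ℝ) (T : ℝ) : ℝ :=
  ∑ i, ∑ j, w i j * q j * (Real.log (p i + T * q j) - Real.log (p i))

theorem dpiG_deriv {I : Type*} [Fintype I] (w : I → I → ℝ) (p q : I → ℝ)
    (hp : ∀ i, 0 < p i) (hq : ∀ i, 0 < q i) (T : ℝ) (hT : 0 ≤ T) :
    HasDerivAt (dpiG w p q) (∑ i, ∑ j, w i j * q j ^ 2 / (p i + T * q j)) T := by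
  unfold dpiG
  refine HasDerivAt.fun_sum fun i _ => HasDerivAt.fun_sum fun j _ => ?_
  have hpos : 0 < p i + T * q j := add_pos_of_pos_of_nonneg (hp i) (mul_nonneg hT (hq j).le)
  have h := ((((hasDerivAt_id T).mul_const (q j)).const_add (p i)).log hpos.ne').sub_const
    (Real.log (p i)) |>.const_mul (w i j * q j)
  refine h.congr_deriv ?_
  rw [id]
  ring

open Filter Topology in
theorem dpiG_tendsto {I : Type*} [Fintype I] (w : I → I → ℝ) (p q : I → ℝ)
    (hp : ∀ i, 0 < p i) (hq : ∀ i, 0 < q i) (hw : ∑ i, ∑ j, w i j * q j = 1) :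
    Tendsto (fun T => dpiG w p q T - Real.log T) atTop
      (𝓝 (∑ i, ∑ j, w i j * q j * (Real.log (q j) - Real.log (p i)))) := by
  have h : Tendsto (fun T : ℝ => ∑ i, ∑ j, w i j * q j * (Real.log (p i * T⁻¹ + q j) - Real.log (p i)))
      atTop (𝓝 (∑ i, ∑ j, w i j * q j * (Real.log (q j) - Real.log (p i)))) := by
    refine tendsto_finsetSum _ fun i _ => tendsto_finsetSum _ fun j _ => ?_
    refine Tendsto.const_mul _ (Tendsto.sub_const (Tendsto.log ?_ (hq j).ne') _)
    simpa using (tendsto_inv_atTop_zero.const_mul (p i)).add_const (q j)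
  refine h.congr' ?_
  filter_upwards [eventually_gt_atTop 0] with T hT
  have : Real.log T = ∑ i, ∑ j, w i j * q j * Real.log T := by
    simp only [← Finset.sum_mul, hw, one_mul]
  rw [this, dpiG]
  simp only [← Finset.sum_sub_distrib]
  refine Finset.sum_congr rfl fun i _ => Finset.sum_congr rfl fun j _ => ?_
  have h1 : p i + T * q j = T * (p i * T⁻¹ + q j) := by field_simp
  have h2 : p i * T⁻¹ + q j ≠ 0 :=
    (add_pos (mul_pos (hp i) (inv_pos.2 hT)) (hq j)).ne'
  rw [h1, Real.log_mul hT.ne' h2]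
  ring

theorem stmt_18 {n m K : ℕ} (ρ σ : Matrix (Fin n) (Fin n) ℂ)
    (hρ : ρ.PosDef) (hσ : σ.PosDef) (hρ1 : ρ.trace = 1) (hσ1 : σ.trace = 1)
    (A : Fin K → Matrix (Fin m) (Fin n) ℂ)
    (hA : ∑ k, (A k)ᴴ * A k = 1)
    (Φ : Matrix (Fin n) (Fin n) ℂ → Matrix (Fin m) (Fin m) ℂ)
    (hΦ : ∀ X, Φ X = ∑ k, A k * X * (A k)ᴴ)
    (hΦρ : (Φ ρ).PosDef) (hΦσ : (Φ σ).PosDef) :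
    qRelEnt (Φ σ) (Φ ρ) ≤ qRelEnt σ ρ := by
  have hTr : (Φ σ).trace = 1 := by
    rw [hΦ, Matrix.trace_sum]
    have : ∀ k, (A k * σ * (A k)ᴴ).trace = (σ * ((A k)ᴴ * A k)).trace := by
      intro k
      rw [Matrix.mul_assoc, Matrix.trace_mul_comm, Matrix.mul_assoc]
    simp only [this]
    rw [← Matrix.trace_sum, ← Finset.mul_sum, hA, Matrix.mul_one, hσ1]
  obtain ⟨w, p, q, hp, hq, hw, hD, hle, -⟩ := dpi_spectral σ ρ hσ hρ hσ1
  obtain ⟨w', p', q', hp', hq', hw', hD', -, hex⟩ := dpi_spectral (Φ σ) (Φ ρ) hΦσ hΦρ hTr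
  have hcmp : ∀ t, 0 ≤ t → ∑ i, ∑ j, w' i j * q' j ^ 2 / (p' i + t * q' j)
      ≤ ∑ i, ∑ j, w i j * q j ^ 2 / (p i + t * q j) := by
    intro t ht
    obtain ⟨Y, hY⟩ := hex t ht
    rw [← hY]
    refine le_trans ?_ (hle t ht (∑ k, (A k)ᴴ * Y * A k))
    have k1 := dpi_kadison ρ hρ A hA Y _ rfl
    have hXH : (∑ k, (A k)ᴴ * Y * A k)ᴴ = ∑ k, (A k)ᴴ * Yᴴ * A k := by
      rw [Matrix.conjTranspose_sum]
      simp [Matrix.mul_assoc]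
    have k2 := dpi_kadison σ hσ A hA Yᴴ _ hXH
    rw [Matrix.conjTranspose_conjTranspose, Matrix.conjTranspose_conjTranspose, ← hΦ] at k2
    rw [← hΦ] at k1
    have k3 : (Φ σ * Y).trace = (σ * ∑ k, (A k)ᴴ * Y * A k).trace := by
      rw [hΦ, Finset.sum_mul, Finset.mul_sum, Matrix.trace_sum, Matrix.trace_sum]
      refine Finset.sum_congr rfl fun k _ => ?_
      rw [Matrix.mul_assoc (A k), Matrix.mul_assoc (A k), Matrix.trace_mul_comm]
      simp only [Matrix.mul_assoc]
    have k4 := mul_le_mul_of_nonneg_left k2 ht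
    rw [dpiF, dpiF, k3]
    linarith
  have hd : ∀ T, 0 ≤ T → HasDerivAt (fun T => dpiG w p q T - dpiG w' p' q' T) _ T := fun T hT =>
    (dpiG_deriv w p q hp hq T hT).sub (dpiG_deriv w' p' q' hp' hq' T hT)
  have hmono : MonotoneOn (fun T => dpiG w p q T - dpiG w' p' q' T) (Set.Ici 0) := by
    refine monotoneOn_of_deriv_nonneg (convex_Ici 0)
      (fun T hT => (hd T hT).continuousAt.continuousWithinAt) ?_ ?_
    · intro T hT
      rw [interior_Ici] at hT
      exact (hd T (le_of_lt hT)).differentiableAt.differentiableWithinAt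
    · intro T hT
      rw [interior_Ici] at hT
      rw [(hd T (le_of_lt hT)).deriv]
      exact sub_nonneg.2 (hcmp T (le_of_lt hT))
  rw [hD, hD']
  refine le_of_tendsto_of_tendsto (dpiG_tendsto w' p' q' hp' hq' hw')
    (dpiG_tendsto w p q hp hq hw) ?_
  filter_upwards [Filter.eventually_ge_atTop 0] with T hT
  have h := hmono (Set.mem_Ici.2 le_rfl) (Set.mem_Ici.2 hT) hT
  simp only [dpiG, zero_mul, add_zero, sub_self, mul_zero, Finset.sum_const_zero] at h
  simp only [dpiG]
  linarith
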